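/- arXiv:2303.12412 — 2 statements merged into one kernel-verified Lean document; each statement's English description precedes it below -/
import Mathlib

section
/- Let n > d and let f be a polynomial in ℂ[x_{ij} : 1 ≤ i ≤ n, 1 ≤ j ≤ d]. For 1 ≤ i, j ≤ n let D_{ij} be the unique ℂ-derivation of ℂ[x_{ij}] with D_{ij}(x_{hk}) = δ_{jh} x_{ik} for all 1 ≤ h ≤ n, 1 ≤ k ≤ d. Then Σ_{σ ∈ S_n} sgn(σ) (D_{σ(1),1} + δ_{σ(1),1}(n−1)·id) ∘ (D_{σ(2),2} + δ_{σ(2),2}(n−2)·id) ∘ ⋯ ∘ (D_{σ(n),n} + δ_{σ(n),n}·0·id) applied to f is zero (the classical Capelli identity in the case n > d). -/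
noncomputable section

open MvPolynomial

/-- The derivation `D_{ij}` of `ℂ[x_{hk} : 1 ≤ h ≤ n, 1 ≤ k ≤ d]` with
`D_{ij}(x_{hk}) = δ_{jh} x_{ik}` (the polarization operator). -/
def Dpol (n d : ℕ) (i j : Fin n) :
    Derivation ℂ (MvPolynomial (Fin n × Fin d) ℂ) (MvPolynomial (Fin n × Fin d) ℂ) :=
  MvPolynomial.mkDerivation ℂ (fun p : Fin n × Fin d =>
    if p.1 = j then MvPolynomial.X (i, p.2) else 0)


section Abstract

variable {ι κ R : Type*} [DecidableEq ι] [Fintype κ] [DecidableEq κ] [Ring R]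

/-- Normally ordered product. -/
def NO (X P : ι → κ → R) (i : ι → ι) : List ι → R
  | [] => 1
  | j :: l => ∑ k, X (i j) k * NO X P i l * P j k

theorem NO_congr (X P : ι → κ → R) (i i' : ι → ι) (l : List ι) (h : ∀ b ∈ l, i b = i' b) :
    NO X P i l = NO X P i' l := by
  induction l with
  | nil => rfl
  | cons b t ih =>
    simp only [NO]
    rw [ih (fun c hc => h c (List.mem_cons_of_mem _ hc)), h b List.mem_cons_self]

theorem NO_comm (X P : ι → κ → R)
    (hXX : ∀ a b k l, X a k * X b l = X b l * X a k)
    (hPP : ∀ a b k l, P a k * P b l = P b l * P a k)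
    (hPX : ∀ j i k l, P j k * X i l = X i l * P j k + if i = j ∧ k = l then 1 else 0)
    (i : ι → ι) (a j : ι) (l : List ι) (hl : l.Nodup) :
    (∑ k, X a k * P j k) * NO X P i l = ∑ k, X a k * NO X P i l * P j k +
      (l.map fun b => if i b = j then NO X P (Function.update i b a) l else 0).sum := by
  induction l with
  | nil => simp [NO]
  | cons b t ih =>
    obtain ⟨hb, ht⟩ := List.nodup_cons.mp hl
    have ih := ih ht
    have h1 : (∑ k, X a k * P j k) * NO X P i (b :: t) =
        ∑ l, X (i b) l * ((∑ k, X a k * P j k) * NO X P i t) * P b l +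
        if i b = j then ∑ l, X a l * NO X P i t * P b l else 0 := by
      have : ∀ l, (∑ k, X a k * P j k) * X (i b) l = X (i b) l * (∑ k, X a k * P j k) +
          if i b = j then X a l else 0 := by
        intro l
        rw [Finset.sum_mul, Finset.mul_sum]
        simp only [mul_assoc, hPX, mul_add, Finset.sum_add_distrib]
        congr 1
        · exact Finset.sum_congr rfl fun k _ => by rw [← mul_assoc, hXX, mul_assoc]
        · by_cases h : i b = j <;> simp [h]
      simp only [NO]
      rw [Finset.mul_sum]
      simp only [← mul_assoc, this, add_mul, Finset.sum_add_distrib]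
      congr 1
      by_cases h : i b = j <;> simp [h]
    have h2 : ((t.map fun c => if i c = j then NO X P (Function.update i c a) (b :: t) else 0).sum)
        = ∑ l, X (i b) l *
          (t.map fun c => if i c = j then NO X P (Function.update i c a) t else 0).sum * P b l := by
      have : ∀ s : List ι, b ∉ s →
        ((s.map fun c => if i c = j then NO X P (Function.update i c a) (b :: t) else 0).sum)
        = ∑ l, X (i b) l *
          (s.map fun c => if i c = j then NO X P (Function.update i c a) t else 0).sum * P b l := by
        intro s hs
        induction s with
        | nil => simp
        | cons c s ihs =>
          simp only [List.mem_cons, not_or] at hs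
          simp only [List.map_cons, List.sum_cons, mul_add, add_mul, Finset.sum_add_distrib]
          rw [ihs hs.2]
          congr 1
          by_cases h : i c = j
          · simp [h, NO, Function.update_of_ne hs.1]
          · simp [h]
      exact this t hb
    rw [h1, ih, List.map_cons, List.sum_cons, h2]
    simp only [mul_add, add_mul, Finset.sum_add_distrib]
    have h3 : (if i b = j then NO X P (Function.update i b a) (b :: t) else 0) =
       if i b = j then ∑ l, X a l * NO X P i t * P b l else 0 := by
      by_cases h : i b = j
      · simp only [h, if_true, NO, Function.update_self]
        rw [NO_congr X P (Function.update i b a) i t]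
        intro c hc
        rw [Function.update_of_ne]
        rintro rfl
        exact hb hc
      · simp [h]
    have h4 : ∑ l, X (i b) l * (∑ k, X a k * NO X P i t * P j k) * P b l =
        ∑ k, X a k * NO X P i (b :: t) * P j k := by
      simp only [NO, Finset.mul_sum, Finset.sum_mul]
      rw [Finset.sum_comm]
      refine Finset.sum_congr rfl fun k _ => Finset.sum_congr rfl fun l _ => ?_
      calc _ = (X (i b) l * X a k) * NO X P i t * (P j k * P b l) := by simp only [mul_assoc]
        _ = (X a k * X (i b) l) * NO X P i t * (P b l * P j k) := by rw [hXX, hPP]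
        _ = _ := by simp only [mul_assoc]
    rw [h3, h4]
    abel

theorem cap_step [Fintype ι] (X P : ι → κ → R)
    (hXX : ∀ a b k l, X a k * X b l = X b l * X a k)
    (hPP : ∀ a b k l, P a k * P b l = P b l * P a k)
    (hPX : ∀ j i k l, P j k * X i l = X i l * P j k + if i = j ∧ k = l then 1 else 0)
    (F : Equiv.Perm ι → R) (j : ι) (l : List ι) (hl : (j :: l).Nodup)
    (hF : ∀ σ, ∀ b ∈ l, F (σ * Equiv.swap j b) = F σ) :
    ∑ σ : Equiv.Perm ι, (Equiv.Perm.sign σ : ℤ) • (F σ * (((∑ k, X (σ j) k * P j k) +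
      if σ j = j then (l.length : R) else 0) * NO X P σ l)) =
    ∑ σ : Equiv.Perm ι, (Equiv.Perm.sign σ : ℤ) • (F σ * NO X P σ (j :: l)) := by
  obtain ⟨hj, hl⟩ := List.nodup_cons.mp hl
  simp only [add_mul, NO_comm X P hXX hPP hPX _ _ _ l hl, mul_add, smul_add,
    Finset.sum_add_distrib]
  rw [add_assoc]
  change _ = ∑ σ : Equiv.Perm ι, (Equiv.Perm.sign σ : ℤ) •
    (F σ * ∑ k, X (σ j) k * NO X P σ l * P j k)
  refine add_eq_left.mpr ?_
  have key : ∀ s : List ι, (∀ b ∈ s, b ∈ l) →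
    ∑ σ : Equiv.Perm ι, (Equiv.Perm.sign σ : ℤ) • (F σ *
      (s.map fun b => if σ b = j then NO X P (Function.update σ b (σ j)) l else 0).sum) +
    ∑ σ : Equiv.Perm ι, (Equiv.Perm.sign σ : ℤ) • (F σ *
      ((if σ j = j then (s.length : R) else 0) * NO X P σ l)) = 0 := by
    intro s hs
    induction s with
    | nil => simp
    | cons b s ih =>
      have ih := ih (fun c hc => hs c (List.mem_cons_of_mem _ hc))
      have hb : b ∈ l := hs b List.mem_cons_self
      have hbj : b ≠ j := by rintro rfl; exact hj hb
      have e : ∑ σ : Equiv.Perm ι, (Equiv.Perm.sign σ : ℤ) • (F σ *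
          (if σ b = j then NO X P (Function.update σ b (σ j)) l else 0)) +
          ∑ σ : Equiv.Perm ι, (Equiv.Perm.sign σ : ℤ) • (F σ *
            ((if σ j = j then (1 : R) else 0) * NO X P σ l)) = 0 := by
        rw [← Equiv.sum_comp (Equiv.mulRight (Equiv.swap j b)), ← Finset.sum_add_distrib]
        refine Finset.sum_eq_zero fun σ _ => ?_
        have hu : NO X P (Function.update (⇑(σ * Equiv.swap j b)) b ((σ * Equiv.swap j b) j)) l =
            NO X P σ l := by
          apply NO_congr
          intro c hc
          by_cases hcb : c = b
          · subst hcb; simp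
          · rw [Function.update_of_ne hcb, Equiv.Perm.mul_apply, Equiv.swap_apply_of_ne_of_ne _ hcb]
            rintro rfl; exact hj hc
        simp only [Equiv.coe_mulRight, hF σ b hb, hu]
        by_cases h : σ j = j <;> simp [h, Equiv.Perm.sign_mul, Equiv.Perm.sign_swap hbj.symm]
      have e2 := congrArg₂ (· + ·) e ih
      simp only [add_zero] at e2
      refine Eq.trans ?_ e2
      have hh : ∀ σ : Equiv.Perm ι, (if σ j = j then ((b :: s).length : R) else 0) =
          (if σ j = j then (1 : R) else 0) + if σ j = j then (s.length : R) else 0 := by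
        intro σ
        by_cases h : σ j = j <;> simp [h, add_comm]
      simp only [List.map_cons, List.sum_cons, hh, mul_add, add_mul, smul_add,
        Finset.sum_add_distrib]
      abel
  exact key l (fun _ h => h)

end Abstract

theorem cap_main {n : ℕ} {κ R : Type*} [Fintype κ] [DecidableEq κ] [Ring R]
    (X P : Fin n → κ → R)
    (hXX : ∀ a b k l, X a k * X b l = X b l * X a k)
    (hPP : ∀ a b k l, P a k * P b l = P b l * P a k)
    (hPX : ∀ j i k l, P j k * X i l = X i l * P j k + if i = j ∧ k = l then 1 else 0)
    (T : Equiv.Perm (Fin n) → Fin n → R)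
    (hT : ∀ σ j, T σ j = (∑ k, X (σ j) k * P j k) + if σ j = j then ((n - 1 - j : ℕ) : R) else 0)
    (l₂ l₁ : List (Fin n)) (h : l₁ ++ l₂ = List.finRange n) :
    ∑ σ : Equiv.Perm (Fin n), (Equiv.Perm.sign σ : ℤ) • ((l₁.map (T σ)).prod * (l₂.map (T σ)).prod) =
    ∑ σ : Equiv.Perm (Fin n), (Equiv.Perm.sign σ : ℤ) • ((l₁.map (T σ)).prod * NO X P σ l₂) := by
  induction l₂ generalizing l₁ with
  | nil => simp [NO]
  | cons j l ih =>
    have ih := ih (l₁ ++ [j]) (by simpa using h)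
    have hnd : (l₁ ++ j :: l).Nodup := h ▸ List.nodup_finRange n
    have hlen : l₁.length + (l.length + 1) = n := by
      have := congrArg List.length h
      simpa using this
    have hjv : (j : ℕ) = l₁.length := by
      have : (l₁ ++ j :: l)[l₁.length]'(by simp) = (List.finRange n)[l₁.length]'(by simp; omega) := by
        simp only [h]
      simp at this
      rw [this]
    have hll : n - 1 - (j : ℕ) = l.length := by omega
    obtain ⟨hn1, hn2, hdis⟩ := List.nodup_append'.mp hnd
    rw [← cap_step X P hXX hPP hPX (fun σ => (l₁.map (T σ)).prod) j l hn2]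
    · simp only [List.map_append, List.prod_append, List.map_cons, List.map_nil, List.prod_cons,
        List.prod_nil, mul_one, mul_assoc] at ih ⊢
      rw [ih]
      simp only [hT _ j, hll]
    · intro σ b hb
      have : l₁.map (T (σ * Equiv.swap j b)) = l₁.map (T σ) := by
        apply List.map_congr_left
        intro c hc
        have hcj : c ≠ j := by rintro rfl; exact hdis hc List.mem_cons_self
        have hcb : c ≠ b := by rintro rfl; exact hdis hc (List.mem_cons_of_mem _ hb)
        simp [hT, Equiv.swap_apply_of_ne_of_ne hcj hcb]
      simp only [this]

theorem NO_expand {n : ℕ} {κ A R : Type*} [Fintype κ] [CommRing A] [Ring R]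
    (φ : A →+* R) (x : Fin n → κ → A) (P : Fin n → κ → R) (m : ℕ) (c : Fin m → Fin n) :
    ∃ Q : (Fin m → κ) → R, ∀ i : Fin n → Fin n,
      NO (fun a k => φ (x a k)) P i (List.ofFn c) =
        ∑ k : Fin m → κ, φ (∏ a, x (i (c a)) (k a)) * Q k := by
  induction m with
  | zero => exact ⟨fun _ => 1, fun i => by simp [NO]⟩
  | succ m ih =>
    obtain ⟨Q, hQ⟩ := ih (fun a => c a.succ)
    refine ⟨fun k => Q (Fin.tail k) * P (c 0) (k 0), fun i => ?_⟩
    rw [← (Fin.consEquiv (fun _ : Fin (m+1) => κ)).sum_comp, Fintype.sum_prod_type]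
    rw [List.ofFn_succ]
    simp only [NO, hQ, Finset.mul_sum, Finset.sum_mul]
    refine Finset.sum_congr rfl fun k _ => Finset.sum_congr rfl fun l _ => ?_
    simp [Fin.consEquiv, Fin.prod_univ_succ, mul_assoc]

theorem NO_alt {n d : ℕ} (hnd : d < n) {A R : Type*} [CommRing A] [Ring R]
    (φ : A →+* R) (x : Fin n → Fin d → A) (P : Fin n → Fin d → R) :
    ∑ σ : Equiv.Perm (Fin n), (Equiv.Perm.sign σ : ℤ) •
      NO (fun a k => φ (x a k)) P σ (List.finRange n) = 0 := by
  obtain ⟨Q, hQ⟩ := NO_expand φ x P n id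
  rw [List.ofFn_id] at hQ
  simp only [hQ, Finset.smul_sum]
  rw [Finset.sum_comm]
  refine Finset.sum_eq_zero fun k _ => ?_
  simp only [← smul_mul_assoc, ← map_zsmul]
  rw [← Finset.sum_mul, ← map_sum]
  have : ∑ σ : Equiv.Perm (Fin n), (Equiv.Perm.sign σ : ℤ) • ∏ a, x (σ (id a)) (k a) = 0 := by
    obtain ⟨a, b, hab, hk⟩ := Fintype.exists_ne_map_eq_of_card_lt k (by simpa using hnd)
    have := Matrix.det_zero_of_column_eq (M := Matrix.of fun i j => x i (k j)) hab
      (fun i => by simp [hk])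
    rw [Matrix.det_apply] at this
    simpa [Units.smul_def] using this
  rw [this]; simp

theorem der_sum {A κ : Type*} [CommRing A] [Algebra ℂ A] (s : Finset κ) (D : κ → Derivation ℂ A A)
    (f : A) : (∑ k ∈ s, D k) f = ∑ k ∈ s, D k f := by
  classical
  induction s using Finset.induction_on with
  | empty => simp
  | insert a s ha ih => simp [Finset.sum_insert ha, ih]

theorem pd_comm {τ : Type*} (a b : τ) :
    ((pderiv a).toLinearMap : Module.End ℂ (MvPolynomial τ ℂ)) * ((pderiv b).toLinearMap : Module.End ℂ (MvPolynomial τ ℂ)) =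
      ((pderiv b).toLinearMap : Module.End ℂ (MvPolynomial τ ℂ)) *
        ((pderiv a).toLinearMap : Module.End ℂ (MvPolynomial τ ℂ)) := by
  classical
  have h : ⁅(pderiv a : Derivation ℂ (MvPolynomial τ ℂ) (MvPolynomial τ ℂ)),
      (pderiv b : Derivation ℂ (MvPolynomial τ ℂ) (MvPolynomial τ ℂ))⁆ = 0 := by
    apply MvPolynomial.derivation_ext
    intro p
    simp only [Derivation.commutator_apply, pderiv_X, Pi.single_apply]
    split_ifs <;> simp
  apply LinearMap.ext
  intro f
  have h2 := DFunLike.congr_fun h f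
  rw [Derivation.commutator_apply] at h2
  exact sub_eq_zero.mp h2

/-- **The classical Capelli identity (case `n > d`)**: the operator column determinant
`Σ_σ sgn(σ) (D_{σ(1),1} + δ_{σ(1),1}(n−1)) ∘ ⋯ ∘ (D_{σ(n),n} + δ_{σ(n),n}·0)` annihilates
every polynomial `f ∈ ℂ[x_{ij} : 1 ≤ i ≤ n, 1 ≤ j ≤ d]`. -/
theorem capelli_identity_rect (n d : ℕ) (hnd : d < n)
    (f : MvPolynomial (Fin n × Fin d) ℂ) :
    (∑ σ : Equiv.Perm (Fin n), (Equiv.Perm.sign σ : ℤ) •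
      (List.ofFn fun j : Fin n =>
        ((Dpol n d (σ j) j).toLinearMap : Module.End ℂ (MvPolynomial (Fin n × Fin d) ℂ)) +
          (if σ j = j then ((n : ℂ) - 1 - (j : ℕ)) else 0) • 1).prod) f = 0 := by
  have hD : ∀ i j : Fin n, ((Dpol n d i j).toLinearMap :
      Module.End ℂ (MvPolynomial (Fin n × Fin d) ℂ)) =
      ∑ k, Algebra.lmul ℂ (MvPolynomial (Fin n × Fin d) ℂ) (X (i, k)) *
        ((pderiv (j, k)).toLinearMap : Module.End ℂ (MvPolynomial (Fin n × Fin d) ℂ)) := by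
    intro i j
    have : Dpol n d i j = ∑ k, (X (i, k) : MvPolynomial (Fin n × Fin d) ℂ) • pderiv (j, k) := by
      apply MvPolynomial.derivation_ext
      rintro ⟨h, l⟩
      rw [Dpol, mkDerivation_X]
      rw [der_sum]
      simp only [Derivation.smul_apply, pderiv_X, smul_eq_mul,
        Pi.single_apply, Prod.mk.injEq]
      by_cases hh : h = j <;> simp [hh]
    apply LinearMap.ext
    intro f
    rw [this]
    rw [Derivation.coeFn_coe, der_sum, LinearMap.sum_apply]
    simp
  have main := cap_main (n := n) (κ := Fin d)
    (fun i k => (Algebra.lmul ℂ (MvPolynomial (Fin n × Fin d) ℂ)).toRingHom (X (i, k)))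
    (fun j k => ((pderiv (j, k)).toLinearMap : Module.End ℂ (MvPolynomial (Fin n × Fin d) ℂ)))
    (fun a b k l => by rw [← map_mul, mul_comm, map_mul])
    (fun a b k l => by
      exact pd_comm (a, k) (b, l))
    (fun j i k l => by
      apply LinearMap.ext
      intro f
      by_cases h : i = j ∧ k = l
      · obtain ⟨rfl, rfl⟩ := h
        simp [Derivation.leibniz, pderiv_X]
      · have h' : ¬ ((i, l) = (j, k)) := by
          simp only [Prod.mk.injEq]
          rintro ⟨h1, h2⟩
          exact h ⟨h1, h2.symm⟩
        simp [Derivation.leibniz, pderiv_X, h, h', Pi.single_apply])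
    (fun σ j => ((Dpol n d (σ j) j).toLinearMap : Module.End ℂ (MvPolynomial (Fin n × Fin d) ℂ)) +
          (if σ j = j then ((n : ℂ) - 1 - (j : ℕ)) else 0) • 1)
    (fun σ j => by
      rw [hD]
      congr 1
      by_cases h : σ j = j
      · simp only [h, if_true]
        have : ((n : ℂ) - 1 - (j : ℕ)) = ((n - 1 - j : ℕ) : ℂ) := by
          have := j.2
          rw [Nat.cast_sub (by omega), Nat.cast_sub (by omega)]
          simp
        rw [this, ← Algebra.algebraMap_eq_smul_one, map_natCast]
      · simp [h])
    (List.finRange n) [] (by simp)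
  simp only [List.map_nil, List.prod_nil, one_mul] at main
  rw [NO_alt hnd] at main
  simp only [List.ofFn_eq_map]
  rw [main]
  simp
end
end

section
/- Let ℂ[M_{n,n}] = ℂ[x_{ij} : 1 ≤ i, j ≤ n] and for 1 ≤ i, j ≤ n let D_{ij} be the unique ℂ-derivation of ℂ[M_{n,n}] with D_{ij}(x_{hk}) = δ_{jh} x_{ik} − δ_{ki} x_{hj} for all h, k (the adjoint action of e_{ij} ∈ gl(n)). Then the algebra of invariants ℂ[M_{n,n}]^{ad} = { f : D_{ij}(f) = 0 for all i, j } equals ℂ[h_1(n), h_2(n), …, h_n(n)], where h_k(n) = Σ_{1 ≤ i_1 < ⋯ < i_k ≤ n} det([x_{i_a, i_b}]_{a,b=1,…,k}) is the sum of principal k × k minors of the generic matrix [x_{ij}]; moreover h_1(n), …, h_n(n) are algebraically independent over ℂ. -/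
noncomputable section

open MvPolynomial

/-- The adjoint-action derivation of `e_{ij} ∈ gl(n)` on the coordinate ring
`ℂ[M_{n,n}] = ℂ[x_{hk}]`: the unique `ℂ`-derivation with
`D_{ij}(x_{hk}) = δ_{jh} x_{ik} − δ_{ki} x_{hj}`. -/
def adDer (n : ℕ) (i j : Fin n) :
    Derivation ℂ (MvPolynomial (Fin n × Fin n) ℂ) (MvPolynomial (Fin n × Fin n) ℂ) :=
  MvPolynomial.mkDerivation ℂ (fun p : Fin n × Fin n =>
    (if p.1 = j then MvPolynomial.X (i, p.2) else 0) -
      (if p.2 = i then MvPolynomial.X (p.1, j) else 0))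

/-- `h_k(n) = Σ_{1 ≤ i_1 < ⋯ < i_k ≤ n} det([x_{i_a i_b}]_{a,b=1,…,k})`, the sum of the
principal `k × k` minors of the generic matrix `[x_{ij}]`. -/
def principalMinorSum (n k : ℕ) : MvPolynomial (Fin n × Fin n) ℂ :=
  ∑ f ∈ Finset.univ.filter (fun f : Fin k → Fin n => ∀ a b : Fin k, a < b → f a < f b),
    Matrix.det (Matrix.of fun a b : Fin k => MvPolynomial.X (f a, f b))

/-- evaluation of a polynomial at a matrix -/
def evM {n : ℕ} (A : Matrix (Fin n) (Fin n) ℂ) :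
    MvPolynomial (Fin n × Fin n) ℂ →ₐ[ℂ] ℂ :=
  MvPolynomial.aeval (fun p => A p.1 p.2)

lemma evM_X {n : ℕ} (A : Matrix (Fin n) (Fin n) ℂ) (p : Fin n × Fin n) :
    evM A (X p) = A p.1 p.2 := by simp [evM]

lemma evM_ext {n : ℕ} {f g : MvPolynomial (Fin n × Fin n) ℂ}
    (h : ∀ A, evM A f = evM A g) : f = g := by
  apply MvPolynomial.funext
  intro x
  have := h (Matrix.of fun i j => x (i, j))
  simpa [evM, MvPolynomial.aeval_eq_eval] using this

lemma evM_pm {n : ℕ} (A : Matrix (Fin n) (Fin n) ℂ) (k : ℕ) (hk : k ≤ n) :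
    evM A (principalMinorSum n k) = (-1) ^ k * A.charpoly.coeff (n - k) := by
  have h := A.charpoly_coeff_eq_sum_minors k (by simpa using hk)
  rw [Fintype.card_fin] at h
  rw [h, ← mul_assoc, ← mul_pow]
  simp only [mul_neg, mul_one, neg_neg, one_pow, one_mul]
  rw [principalMinorSum, map_sum]
  have hdet : ∀ f : Fin k → Fin n,
      evM A (Matrix.det (Matrix.of fun a b : Fin k => MvPolynomial.X (f a, f b))) =
      (A.submatrix f f).det := by
    intro f
    rw [AlgHom.map_det]
    congr 1
    ext a b
    simp [evM_X]
  refine Finset.sum_bij (fun f _ => Finset.univ.image f) ?_ ?_ ?_ ?_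
  · intro f hf
    have hf' : StrictMono f := fun a b => (Finset.mem_filter.1 hf).2 a b
    simp [Finset.mem_powersetCard, Finset.card_image_of_injective _ hf'.injective]
  · intro f hf g hg hfg
    have hf' : StrictMono f := fun a b => (Finset.mem_filter.1 hf).2 a b
    have hg' : StrictMono g := fun a b => (Finset.mem_filter.1 hg).2 a b
    have hc : (Finset.univ.image g).card = k := by
      simp [Finset.card_image_of_injective _ hg'.injective]
    exact (Finset.orderEmbOfFin_unique hc (f := f) (fun x => by rw [← hfg]; simp) hf').trans
      (Finset.orderEmbOfFin_unique hc (f := g) (fun x => by simp) hg').symm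
  · intro s hs
    have hc := (Finset.mem_powersetCard.1 hs).2
    refine ⟨s.orderEmbOfFin hc, ?_, ?_⟩
    · simp
    · apply Finset.coe_injective
      rw [Finset.coe_image, Finset.coe_univ, Set.image_univ, Finset.range_orderEmbOfFin]
  · intro f hf
    have hf' : StrictMono f := fun a b => (Finset.mem_filter.1 hf).2 a b
    rw [hdet]
    let e : Fin k ≃ (Finset.univ.image f : Finset (Fin n)) :=
      Equiv.ofBijective (fun a => ⟨f a, by simp⟩)
        ⟨fun a b hab => hf'.injective (by simpa using hab), fun ⟨x, hx⟩ => by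
          obtain ⟨a, -, ha⟩ := Finset.mem_image.1 hx
          exact ⟨a, Subtype.ext ha⟩⟩
    rw [← Matrix.det_submatrix_equiv_self e]
    rfl

/-- the derivation attached to a matrix -/
def adE {n : ℕ} (E : Matrix (Fin n) (Fin n) ℂ) :
    Derivation ℂ (MvPolynomial (Fin n × Fin n) ℂ) (MvPolynomial (Fin n × Fin n) ℂ) :=
  ∑ i, ∑ j, E j i • adDer n i j

lemma adE_apply {n : ℕ} (E : Matrix (Fin n) (Fin n) ℂ) (f) :
    adE E f = ∑ i, ∑ j, E j i • adDer n i j f := by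
  have key : ∀ (g : Fin n → Derivation ℂ (MvPolynomial (Fin n × Fin n) ℂ)
      (MvPolynomial (Fin n × Fin n) ℂ)), (∑ i, g i) f = ∑ i, g i f := by
    intro g
    rw [← Derivation.coeFnAddMonoidHom_apply, map_sum, Finset.sum_apply]
    rfl
  simp [adE, key]

lemma adE_X {n : ℕ} (E A : Matrix (Fin n) (Fin n) ℂ) (p : Fin n × Fin n) :
    evM A (adE E (X p)) = (E * A - A * E) p.1 p.2 := by
  rw [adE_apply]
  simp only [adDer, mkDerivation_X, map_sum, map_smul, map_sub, smul_eq_mul, mul_sub,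
    Finset.sum_sub_distrib, Matrix.sub_apply, Matrix.mul_apply]
  congr 1
  · refine Finset.sum_congr rfl fun i _ => ?_
    rw [Finset.sum_eq_single p.1] <;> simp +contextual [evM_X, eq_comm]
  · rw [Finset.sum_eq_single p.2] 
    · refine Finset.sum_congr rfl fun i _ => ?_
      simp [evM_X, mul_comm]
    · intro b _ hb
      simp [hb.symm]
    · simp

lemma hasDerivAt_evM {n : ℕ}
    (D : Derivation ℂ (MvPolynomial (Fin n × Fin n) ℂ) (MvPolynomial (Fin n × Fin n) ℂ))
    (Z : ℂ → Matrix (Fin n) (Fin n) ℂ) (t : ℂ)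
    (h : ∀ p : Fin n × Fin n, HasDerivAt (fun s => Z s p.1 p.2) (evM (Z t) (D (X p))) t)
    (f : MvPolynomial (Fin n × Fin n) ℂ) :
    HasDerivAt (fun s => evM (Z s) f) (evM (Z t) (D f)) t := by
  induction f using MvPolynomial.induction_on with
  | C a =>
    have : D (C a) = 0 := D.map_algebraMap a
    rw [this, map_zero]
    have h2 : (fun s => evM (Z s) (C a)) = fun _ => a := by
      funext s; simp [evM]
    rw [h2]; exact hasDerivAt_const _ _
  | add p q hp hq =>
    simp only [map_add]
    exact hp.add hq
  | mul_X p q hp =>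
    simp only [map_mul, Derivation.leibniz, map_add, smul_eq_mul, evM_X]
    have := hp.mul (h q)
    convert! this using 1
    ring

section
attribute [local instance] Matrix.linftyOpNormedRing Matrix.linftyOpNormedAlgebra

lemma hasDerivAt_conj {n : ℕ} (A B : Matrix (Fin n) (Fin n) ℂ) (t : ℂ)
    (ht : IsUnit (1 + t • B)) (p : Fin n × Fin n) :
    HasDerivAt (fun s : ℂ => ((1 + s • B) * A * (1 + s • B)⁻¹) p.1 p.2)
      (((B * (1 + t • B)⁻¹) * ((1 + t • B) * A * (1 + t • B)⁻¹)
        - ((1 + t • B) * A * (1 + t • B)⁻¹) * (B * (1 + t • B)⁻¹)) p.1 p.2) t := by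
  have h1 : HasDerivAt (fun s : ℂ => 1 + s • B) B t := by
    have h0 := ((hasDerivAt_id t).smul_const B).const_add 1
    rw [one_smul] at h0
    exact h0
  obtain ⟨u, hu⟩ := ht
  have h2 : HasDerivAt (fun s : ℂ => Ring.inverse (1 + s • B))
      (-(Ring.inverse (1 + t • B) * B * Ring.inverse (1 + t • B))) t := by
    have h3 := hasFDerivAt_ringInverse (𝕜 := ℂ) u
    rw [hu] at h3
    have h4 := h3.comp_hasDerivAt t h1
    rw [← hu, Ring.inverse_unit]
    simpa using! h4
  have h5 := (h1.mul_const A).mul h2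
  have h6 : HasDerivAt (fun s : ℂ => ((1 + s • B) * A * (1 + s • B)⁻¹))
      (((B * (1 + t • B)⁻¹) * ((1 + t • B) * A * (1 + t • B)⁻¹)
        - ((1 + t • B) * A * (1 + t • B)⁻¹) * (B * (1 + t • B)⁻¹))) t := by
    simp only [Matrix.nonsing_inv_eq_ringInverse]
    convert! h5 using 1
    have hi : Ring.inverse (1 + t • B) * (1 + t • B) = 1 := by
      rw [← hu, Ring.inverse_unit]; simp
    rw [sub_eq_add_neg, mul_neg]
    congr 1
    · rw [← mul_assoc, ← mul_assoc, mul_assoc B, hi, mul_one]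
    · simp only [mul_assoc]
  let L : Matrix (Fin n) (Fin n) ℂ →L[ℂ] ℂ :=
    LinearMap.toContinuousLinearMap (Matrix.entryLinearMap ℂ ℂ p.1 p.2)
  exact L.hasFDerivAt.comp_hasDerivAt t h6

end

lemma hasDerivAt_main {n : ℕ} (A B : Matrix (Fin n) (Fin n) ℂ) (t : ℂ)
    (ht : IsUnit (1 + t • B)) (f : MvPolynomial (Fin n × Fin n) ℂ) :
    HasDerivAt (fun s : ℂ => evM ((1 + s • B) * A * (1 + s • B)⁻¹) f)
      (evM ((1 + t • B) * A * (1 + t • B)⁻¹) (adE (B * (1 + t • B)⁻¹) f)) t := by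
  apply hasDerivAt_evM (adE (B * (1 + t • B)⁻¹)) (fun s : ℂ => (1 + s • B) * A * (1 + s • B)⁻¹)
  intro p
  rw [adE_X]
  exact hasDerivAt_conj A B t ht p

lemma finite_sing {n : ℕ} (B : Matrix (Fin n) (Fin n) ℂ) :
    {t : ℂ | ¬ IsUnit (1 + t • B)}.Finite := by
  let q : Polynomial ℂ := Matrix.det (1 + (Polynomial.X : Polynomial ℂ) • B.map Polynomial.C)
  have hq : ∀ t, q.eval t = (1 + t • B).det := by
    intro t
    simp only [q]
    rw [← Polynomial.coe_evalRingHom, RingHom.map_det]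
    congr 1
    ext i j
    by_cases hij : i = j <;> simp [hij] <;> ring
  have hq0 : q ≠ 0 := by
    intro h
    have := hq 0
    simp [h] at this
  refine (q.roots.toFinset.finite_toSet).subset ?_
  intro t ht
  simp only [Set.mem_ofPred_eq, Matrix.isUnit_iff_isUnit_det, isUnit_iff_ne_zero, not_not] at ht
  simp [hq0, hq, ht]

lemma inv_conj {n : ℕ} (f : MvPolynomial (Fin n × Fin n) ℂ)
    (hf : ∀ i j : Fin n, adDer n i j f = 0) (A P : Matrix (Fin n) (Fin n) ℂ)
    (hP : IsUnit P) : evM (P * A * P⁻¹) f = evM A f := by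
  set B := P - 1 with hB
  set S : Set ℂ := {t : ℂ | ¬ IsUnit (1 + t • B)} with hS
  have hfin := finite_sing B
  have hd : ∀ t ∈ Sᶜ, HasDerivAt (fun s : ℂ => evM ((1 + s • B) * A * (1 + s • B)⁻¹) f) 0 t := by
    intro t ht
    have := hasDerivAt_main A B t (by simpa [hS] using ht) f
    rwa [adE_apply, Finset.sum_eq_zero, map_zero] at this
    intro i _
    exact Finset.sum_eq_zero fun j _ => by rw [hf, smul_zero]
  have hconn : IsPreconnected Sᶜ :=
    (hfin.countable.isConnected_compl_of_one_lt_rank (by simp)).isPreconnected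
  have := hfin.isClosed.isOpen_compl.is_const_of_deriv_eq_zero hconn
    (fun t ht => (hd t ht).differentiableAt.differentiableWithinAt)
    (fun t ht => (hd t ht).deriv) (x := 1) (y := 0) (by simp [B, hP]) (by simp)
  simpa [B] using this

lemma charpoly_conj {n : ℕ} (A P : Matrix (Fin n) (Fin n) ℂ)
    (hP : IsUnit P) : (P * A * P⁻¹).charpoly = A.charpoly := by
  rw [Matrix.charpoly_mul_comm, ← mul_assoc, Matrix.nonsing_inv_mul, one_mul]
  exact (Matrix.isUnit_iff_isUnit_det P).1 hP

lemma pm_inv {n : ℕ} (k : ℕ) (hk : k ≤ n) (i j : Fin n) :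
    adDer n i j (principalMinorSum n k) = 0 := by
  apply evM_ext
  intro A
  rw [map_zero]
  set B : Matrix (Fin n) (Fin n) ℂ := Matrix.single j i 1 with hB
  have h := hasDerivAt_main A B 0 (by simp) (principalMinorSum n k)
  have hE : adE B = adDer n i j := by
    ext1 x
    simp only [adE_apply]
    rw [Finset.sum_eq_single i, Finset.sum_eq_single j]
    · simp [hB]
    · intro b _ hb; simp [hB, hb.symm]
    · simp
    · intro b _ hb; simp [hB, hb.symm]
    · simp
  simp only [zero_smul, add_zero, inv_one, mul_one, one_mul, hE] at h
  refine h.unique ?_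
  refine (hasDerivAt_const (0 : ℂ) (evM A (principalMinorSum n k))).congr_of_eventuallyEq ?_
  have : {t : ℂ | ¬ IsUnit (1 + t • B)}ᶜ ∈ nhds (0 : ℂ) :=
    (finite_sing B).isClosed.isOpen_compl.mem_nhds (by simp)
  filter_upwards [this] with t ht
  rw [evM_pm _ _ hk, evM_pm _ _ hk, charpoly_conj _ _ (by simpa using ht)]

/-- companion matrix -/
def comp {R : Type*} [CommRing R] {m : ℕ} (q : Fin (m + 1) → R) :
    Matrix (Fin (m + 1)) (Fin (m + 1)) R :=
  Matrix.of fun i j => if j = Fin.last m then - q i else if (i : ℕ) = j + 1 then 1 else 0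

/-- Krylov matrix -/
def kry {R : Type*} [CommRing R] {m : ℕ} (A : Matrix (Fin (m + 1)) (Fin (m + 1)) R) :
    Matrix (Fin (m + 1)) (Fin (m + 1)) R :=
  Matrix.of fun i j => (A ^ (j : ℕ)) i 0

lemma mul_kry {R : Type*} [CommRing R] [Nontrivial R] {m : ℕ}
    (A : Matrix (Fin (m + 1)) (Fin (m + 1)) R) :
    A * kry A = kry A * comp (fun i => A.charpoly.coeff i) := by
  ext i j
  have hl : (A * kry A) i j = (A ^ ((j : ℕ) + 1)) i 0 := by
    rw [pow_succ', Matrix.mul_apply, Matrix.mul_apply]; rfl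
  rw [hl, Matrix.mul_apply]
  by_cases hj : j = Fin.last m
  · subst hj
    have hc := A.aeval_self_charpoly
    rw [Polynomial.aeval_eq_sum_range, Matrix.charpoly_natDegree_eq_dim, Fintype.card_fin,
      Finset.sum_range_succ] at hc
    have hm : A.charpoly.coeff (m + 1) = 1 := by
      have := A.charpoly_monic.coeff_natDegree
      rwa [Matrix.charpoly_natDegree_eq_dim, Fintype.card_fin] at this
    rw [hm, one_smul] at hc
    have hc2 := eq_neg_of_add_eq_zero_right hc
    rw [Fin.val_last, hc2, Finset.sum_range]
    simp only [Matrix.neg_apply, Matrix.sum_apply, Matrix.smul_apply, smul_eq_mul, comp, kry,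
      Matrix.of_apply, if_true, mul_neg, Finset.sum_neg_distrib]
    congr 1
    exact Finset.sum_congr rfl fun x _ => mul_comm _ _
  · have hj' : (j : ℕ) + 1 < m + 1 := by
      have : (j : ℕ) ≠ m := fun h => hj (Fin.ext h)
      omega
    rw [Finset.sum_eq_single ⟨(j : ℕ) + 1, hj'⟩]
    · simp [comp, kry, hj]
    · intro b _ hb
      have : (b : ℕ) ≠ j + 1 := fun h => hb (Fin.ext h)
      simp [comp, hj, this]
    · simp

lemma kry_comp {R : Type*} [CommRing R] {m : ℕ} (q : Fin (m + 1) → R) :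
    kry (comp q) = 1 := by
  have key : ∀ k (hk : k < m + 1) (i : Fin (m + 1)),
      ((comp q) ^ k) i 0 = if (i : ℕ) = k then 1 else 0 := by
    intro k
    induction k with
    | zero => intro _ i; simp only [pow_zero, Matrix.one_apply, Fin.ext_iff, Fin.val_zero]
    | succ k ih =>
      intro hk i
      rw [pow_succ', Matrix.mul_apply, Finset.sum_eq_single ⟨k, by omega⟩]
      · have : (⟨k, by omega⟩ : Fin (m + 1)) ≠ Fin.last m := by
          intro h; have := congrArg Fin.val h; simp at this; omega
        rw [ih (by omega)]
        simp [comp, this]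
      · intro b _ hb
        have : (b : ℕ) ≠ k := fun h => hb (Fin.ext h)
        rw [ih (by omega)]; simp [this]
      · simp
  ext i j
  rw [kry, Matrix.of_apply, key _ j.2]
  simp [Matrix.one_apply, Fin.ext_iff]

lemma charpoly_comp {R : Type*} [CommRing R] [Nontrivial R] {m : ℕ} (q : Fin (m + 1) → R)
    (i : Fin (m + 1)) : (comp q).charpoly.coeff i = q i := by
  have h := mul_kry (comp q)
  rw [kry_comp, mul_one, one_mul] at h
  have := congrFun (congrFun h i) (Fin.last m)
  simpa [comp] using this.symm

/-- coefficients of the characteristic polynomial in terms of `h` -/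
def sg {R : Type*} [CommRing R] {m : ℕ} (c : Fin (m + 1) → R) : Fin (m + 1) → R :=
  fun i => (-1) ^ ((i.rev : ℕ) + 1) * c i.rev

lemma evM_pm_comp {m : ℕ} (c : Fin (m + 1) → ℂ) (k : Fin (m + 1)) :
    evM (comp (sg c)) (principalMinorSum (m + 1) ((k : ℕ) + 1)) = c k := by
  rw [evM_pm _ _ (by omega)]
  have : m + 1 - ((k : ℕ) + 1) = (k.rev : ℕ) := by simp [Fin.val_rev]
  rw [this, charpoly_comp, sg, Fin.rev_rev, ← mul_assoc, ← mul_pow]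
  simp

lemma sg_pm {m : ℕ} (A : Matrix (Fin (m + 1)) (Fin (m + 1)) ℂ) :
    sg (fun k : Fin (m + 1) => evM A (principalMinorSum (m + 1) ((k : ℕ) + 1))) =
      fun i : Fin (m + 1) => A.charpoly.coeff i := by
  funext i
  rw [sg, evM_pm _ _ (by omega), ← mul_assoc, ← mul_pow]
  have : m + 1 - ((i.rev : ℕ) + 1) = (i : ℕ) := by
    rw [Fin.val_rev]; omega
  rw [this]; simp

/-- pullback along the companion slice -/
def slice {m : ℕ} (f : MvPolynomial (Fin (m + 1) × Fin (m + 1)) ℂ) :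
    MvPolynomial (Fin (m + 1)) ℂ :=
  aeval (fun p : Fin (m + 1) × Fin (m + 1) =>
    comp (sg (fun k => (X k : MvPolynomial (Fin (m + 1)) ℂ))) p.1 p.2) f

lemma eval_slice {m : ℕ} (f : MvPolynomial (Fin (m + 1) × Fin (m + 1)) ℂ)
    (c : Fin (m + 1) → ℂ) : aeval c (slice f) = evM (comp (sg c)) f := by
  rw [slice, evM, ← AlgHom.comp_apply, comp_aeval]
  congr 2
  funext p
  simp only [comp, sg, Matrix.of_apply]
  split_ifs <;> simp

lemma main_succ {m : ℕ} (f : MvPolynomial (Fin (m + 1) × Fin (m + 1)) ℂ)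
    (hf : ∀ i j, adDer (m + 1) i j f = 0) :
    f = aeval (fun k : Fin (m + 1) => principalMinorSum (m + 1) ((k : ℕ) + 1)) (slice f) := by
  let M : Matrix (Fin (m + 1)) (Fin (m + 1)) (MvPolynomial (Fin (m + 1) × Fin (m + 1)) ℂ) :=
    Matrix.of fun i j => X (i, j)
  let Q := (kry M).det
  have hQ : ∀ A, evM A Q = (kry A).det := by
    intro A
    have hM : (evM A).mapMatrix M = A := by
      ext i j; simp [M, evM_X]
    simp only [Q]
    rw [AlgHom.map_det]
    congr 1
    ext i j
    simp only [AlgHom.mapMatrix_apply, Matrix.map_apply, kry, Matrix.of_apply]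
    conv_rhs => rw [← hM, ← map_pow]
    simp
  have hQ0 : Q ≠ 0 := by
    intro h
    have := hQ (comp 0)
    rw [kry_comp, h] at this
    simp at this
  have hz : (f - aeval (fun k : Fin (m + 1) => principalMinorSum (m + 1) ((k : ℕ) + 1))
      (slice f)) * Q = 0 := by
    apply evM_ext
    intro A
    rw [map_mul, map_zero, hQ]
    by_cases hd : (kry A).det = 0
    · rw [hd, mul_zero]
    · have hu' : IsUnit (kry A).det := isUnit_iff_ne_zero.2 hd
      have hu : IsUnit (kry A) := (Matrix.isUnit_iff_isUnit_det _).2 hu'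
      have h1 : A = kry A * comp (fun i => A.charpoly.coeff i) * (kry A)⁻¹ := by
        rw [← mul_kry, mul_assoc, Matrix.mul_nonsing_inv _ hu', mul_one]
      have h2 : evM A f = evM (comp (fun i => A.charpoly.coeff i)) f := by
        conv_lhs => rw [h1]
        exact inv_conj f hf _ _ hu
      have h3 : evM A (aeval (fun k : Fin (m + 1) => principalMinorSum (m + 1) ((k : ℕ) + 1))
          (slice f)) = evM (comp (fun i => A.charpoly.coeff i)) f := by
        rw [← sg_pm, ← eval_slice, ← AlgHom.comp_apply, comp_aeval]
      rw [map_sub, h2, h3, sub_self, zero_mul]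
  exact sub_eq_zero.1 ((mul_eq_zero.1 hz).resolve_right hQ0)

/-- **First fundamental theorem for the adjoint action**: the algebra of
`ad(gl(n))`-invariants of `ℂ[M_{n,n}]` equals `ℂ[h_1(n), …, h_n(n)]`, and the polynomials
`h_1(n), …, h_n(n)` are algebraically independent over `ℂ`. -/
theorem adInvariants_eq_polynomial_algebra (n : ℕ) :
    (∀ f : MvPolynomial (Fin n × Fin n) ℂ,
      (∀ i j : Fin n, adDer n i j f = 0) ↔
        f ∈ Algebra.adjoin ℂ
          (Set.range fun k : Fin n => principalMinorSum n ((k : ℕ) + 1))) ∧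
    AlgebraicIndependent ℂ (fun k : Fin n => principalMinorSum n ((k : ℕ) + 1)) := by
  refine ⟨fun f => ⟨fun hf => ?_, fun hf i j => ?_⟩, ?_⟩
  · cases n with
    | zero =>
      rw [MvPolynomial.eq_C_of_isEmpty f]
      exact Subalgebra.algebraMap_mem _ _
    | succ m =>
      rw [main_succ f hf, Algebra.adjoin_range_eq_range_aeval]
      exact ⟨_, rfl⟩
  · induction hf using Algebra.adjoin_induction with
    | mem x hx =>
      obtain ⟨k, rfl⟩ := hx
      exact pm_inv _ (by omega) i j
    | algebraMap r => exact (adDer n i j).map_algebraMap r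
    | add x y _ _ hx hy => rw [map_add, hx, hy, add_zero]
    | mul x y _ _ hx hy => rw [Derivation.leibniz, hx, hy, smul_zero, smul_zero, add_zero]
  · cases n with
    | zero => exact algebraicIndependent_empty_type_iff.2 (algebraMap ℂ _).injective
    | succ m =>
      rw [algebraicIndependent_iff]
      intro p hp
      apply MvPolynomial.funext
      intro c
      have h := congrArg (evM (comp (sg c))) hp
      rw [← AlgHom.comp_apply, comp_aeval, map_zero] at h
      simp only [evM_pm_comp] at h
      rw [map_zero]
      exact h
end
end
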